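/- Let d ≥ 1, κ > 0, Σ a symmetric positive definite d×d real matrix, x a symmetric positive semidefinite d×d real matrix, and let X be a random symmetric positive semidefinite d×d matrix whose Laplace transform satisfies E[e^{−Tr(uX)}] = det(I_d + 2uΣ)^{−κ/2} exp(−Tr(u(I_d + 2uΣ)^{−1} x)) for every symmetric matrix u such that I_d + 2 Σ^{1/2} u Σ^{1/2} is positive definite (noncentral Wishart law W_d(κ, Σ, Σ^{−1}x)). Let A be a symmetric d×d matrix, let Σ^{1/2} A Σ^{1/2} = O Λ Oᵀ be a spectral decomposition with O orthogonal and Λ = diag(λ_1,…,λ_d), and set y := Oᵀ Σ^{−1/2} x Σ^{−1/2} O. Then for every real s with 1 − 2sλ_i > 0 for all i = 1,…,d, E[e^{s Tr(AX)}] = ∏_{i=1}^d (1 − 2sλ_i)^{−κ/2} exp( s λ_i y_{ii} / (1 − 2sλ_i) ); that is, Tr(AX) has the moment generating function of Σ_{i=1}^d λ_i V_i where V_1,…,V_d are independent noncentral chi-square random variables with κ degrees of freedom and noncentrality parameters y_{ii}. -/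

import Mathlib

open MeasureTheory Matrix

/-- If every vector is an eigenvector of `A` or of `B`, then `A` or `B` is scalar. -/
theorem exists_eq_smul_one_of_forall_eigenvector {n : Type*} [Fintype n] [DecidableEq n]
    [Nonempty n] (A B : Matrix n n ℝ)
    (h : ∀ e : n → ℝ, (∃ c : ℝ, A *ᵥ e = c • e) ∨ ∃ c : ℝ, B *ᵥ e = c • e) :
    (∃ c : ℝ, A = c • (1 : Matrix n n ℝ)) ∨ ∃ c : ℝ, B = c • (1 : Matrix n n ℝ) := by
  have scalar : ∀ (M : Matrix n n ℝ) (c : ℝ), Module.End.eigenspace (toLin' M) c = ⊤ →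
      M = c • (1 : Matrix n n ℝ) := by
    intro M c hc
    refine Matrix.toLin'.injective (LinearMap.ext fun v ↦ ?_)
    have hv : v ∈ Module.End.eigenspace (toLin' M) c := hc ▸ Submodule.mem_top
    rw [Module.End.mem_eigenspace_iff] at hv
    rw [hv]
    simp
  have eigen : ∀ (M : Matrix n n ℝ) (e : n → ℝ) (c : ℝ), e ≠ 0 → M *ᵥ e = c • e →
      ∃ c : Module.End.Eigenvalues (toLin' M), e ∈ Module.End.eigenspace (toLin' M) c := by
    intro M e c he hc
    have hmem : e ∈ Module.End.eigenspace (toLin' M) c := by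
      rw [Module.End.mem_eigenspace_iff, toLin'_apply, hc]
    exact ⟨⟨c, Module.End.hasEigenvalue_of_hasEigenvector ⟨hmem, he⟩⟩, hmem⟩
  let p : Module.End.Eigenvalues (toLin' A) ⊕ Module.End.Eigenvalues (toLin' B) →
      Subspace ℝ (n → ℝ) :=
    Sum.elim (fun c ↦ Module.End.eigenspace (toLin' A) c) (fun c ↦ Module.End.eigenspace (toLin' B) c)
  have cover : ∀ e : n → ℝ, e ≠ 0 → ∃ i, e ∈ p i := by
    intro e he
    rcases h e with ⟨c, hc⟩ | ⟨c, hc⟩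
    · obtain ⟨c', hc'⟩ := eigen A e c he hc
      exact ⟨Sum.inl c', hc'⟩
    · obtain ⟨c', hc'⟩ := eigen B e c he hc
      exact ⟨Sum.inr c', hc'⟩
  have hcovers : ⋃ i, (p i : Set (n → ℝ)) = Set.univ := by
    refine Set.eq_univ_of_forall fun e ↦ Set.mem_iUnion.2 ?_
    by_cases he : e = 0
    · obtain ⟨i, -⟩ := cover 1 one_ne_zero
      exact ⟨i, he ▸ (p i).zero_mem⟩
    · exact cover e he
  obtain ⟨c | c, hc⟩ := Subspace.exists_eq_top_of_iUnion_eq_univ hcovers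
  · exact Or.inl ⟨c, scalar A c hc⟩
  · exact Or.inr ⟨c, scalar B c hc⟩

theorem nonneg_of_forall_one_le_log_add {a b c k : ℝ}
    (h : ∀ z : ℝ, 1 ≤ z → 0 ≤ a * Real.log z + b + c / z + k * z) : 0 ≤ k := by
  have hlog : Filter.Tendsto (fun z : ℝ ↦ Real.log z / z) Filter.atTop (nhds 0) :=
    Real.isLittleO_log_id_atTop.tendsto_div_nhds_zero
  have hinv : Filter.Tendsto (fun z : ℝ ↦ z⁻¹) Filter.atTop (nhds 0) := tendsto_inv_atTop_zero
  have hlim : Filter.Tendsto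
      (fun z : ℝ ↦ a * (Real.log z / z) + b * z⁻¹ + c * (z⁻¹ * z⁻¹) + k) Filter.atTop (nhds k) := by
    simpa using (((hlog.const_mul a).add (hinv.const_mul b)).add
      ((hinv.mul hinv).const_mul c)).add_const k
  refine ge_of_tendsto hlim ?_
  filter_upwards [Filter.eventually_ge_atTop 1] with z hz
  have hz0 : 0 < z := by linarith
  have := div_nonneg (h z hz) hz0.le
  convert this using 1
  field_simp

theorem det_one_add_smul_vecMulVec {n : Type*} [Fintype n] [DecidableEq n] (c : ℝ) (e p : n → ℝ) :
    (1 + c • vecMulVec e p).det = 1 + c * (p ⬝ᵥ e) := by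
  rw [← smul_vecMulVec, vecMulVec_eq Unit, det_one_add_replicateCol_mul_replicateRow,
    dotProduct_smul, smul_eq_mul]

theorem one_add_smul_vecMulVec_sub {n : Type*} [Fintype n] [DecidableEq n] (t m : ℝ)
    {e f p q : n → ℝ} (hpf : p ⬝ᵥ f = 0) :
    1 + (2 : ℝ) • (t • vecMulVec e p - m • vecMulVec f q) =
      (1 + (2 * t) • vecMulVec e p) * (1 + (-(2 * m)) • vecMulVec f q) := by
  simp only [add_mul, mul_add, one_mul, mul_one, Matrix.smul_mul, Matrix.mul_smul,
    vecMulVec_mul_vecMulVec, hpf, zero_smul, vecMulVec_zero, smul_zero, add_zero]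
  module

theorem inv_one_add_smul_vecMulVec_sub {n : Type*} [Fintype n] [DecidableEq n] {t m : ℝ}
    {e f p q : n → ℝ} (hpf : p ⬝ᵥ f = 0) (hqe : q ⬝ᵥ e = 0)
    (ht : 1 + 2 * t * (p ⬝ᵥ e) ≠ 0) (hm : 1 - 2 * m * (q ⬝ᵥ f) ≠ 0) :
    (1 + (2 : ℝ) • (t • vecMulVec e p - m • vecMulVec f q))⁻¹ =
      1 - (2 * t / (1 + 2 * t * (p ⬝ᵥ e))) • vecMulVec e p +
        (2 * m / (1 - 2 * m * (q ⬝ᵥ f))) • vecMulVec f q := by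
  apply Matrix.inv_eq_right_inv
  simp only [add_mul, mul_add, sub_mul, mul_sub, one_mul, mul_one, Matrix.smul_mul,
    Matrix.mul_smul, vecMulVec_mul_vecMulVec, hpf, hqe, zero_smul, vecMulVec_zero, smul_zero,
    sub_zero, vecMulVec_smul, zero_sub]
  match_scalars <;> field_simp <;> ring

theorem trace_vecMulVec_mul {n : Type*} [Fintype n] (a b : n → ℝ) (M : Matrix n n ℝ) :
    (vecMulVec a b * M).trace = b ⬝ᵥ (M *ᵥ a) := by
  rw [vecMulVec_mul, trace_vecMulVec, dotProduct_comm, dotProduct_mulVec]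

theorem trace_rankTwo_mul_resolvent_mul {n : Type*} [Fintype n] [DecidableEq n] (t m τ μ : ℝ)
    (e f p q : n → ℝ) (x : Matrix n n ℝ) :
    ((t • vecMulVec e e - m • vecMulVec f f) *
      (1 - τ • vecMulVec e p + μ • vecMulVec f q) * x).trace =
      t * (e ⬝ᵥ (x *ᵥ e)) - m * (f ⬝ᵥ (x *ᵥ f)) - t * τ * ((e ⬝ᵥ e) * (p ⬝ᵥ (x *ᵥ e))) +
      t * μ * ((e ⬝ᵥ f) * (q ⬝ᵥ (x *ᵥ e))) + m * τ * ((e ⬝ᵥ f) * (p ⬝ᵥ (x *ᵥ f))) -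
      m * μ * ((f ⬝ᵥ f) * (q ⬝ᵥ (x *ᵥ f))) := by
  simp only [add_mul, mul_add, sub_mul, mul_sub, mul_one, Matrix.smul_mul,
    Matrix.mul_smul, vecMulVec_mul_vecMulVec, vecMulVec_smul, trace_add, trace_sub, trace_smul,
    trace_vecMulVec_mul, smul_eq_mul, dotProduct_comm f e]
  ring

theorem posDef_one_add_vecMulVec_sub {n : Type*} [Fintype n] [DecidableEq n] {t m : ℝ}
    (g h : n → ℝ) (ht : 0 ≤ t) (hm : 0 ≤ m) (hmh : 2 * m * (h ⬝ᵥ h) < 1) :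
    (1 + (2 : ℝ) • (t • vecMulVec g g - m • vecMulVec h h)).PosDef := by
  refine .of_dotProduct_mulVec_pos ?_ fun v hv ↦ ?_
  · rw [IsHermitian, conjTranspose_eq_transpose_of_trivial]
    simp [transpose_vecMulVec]
  · have hvv : 0 < v ⬝ᵥ v := by simpa using dotProduct_star_self_pos_iff.2 hv
    have hcs : (h ⬝ᵥ v) ^ 2 ≤ (h ⬝ᵥ h) * (v ⬝ᵥ v) := by
      simpa [dotProduct, sq] using Finset.sum_mul_sq_le_sq_mul_sq Finset.univ h v
    have key : star v ⬝ᵥ ((1 + (2 : ℝ) • (t • vecMulVec g g - m • vecMulVec h h)) *ᵥ v) =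
        v ⬝ᵥ v + 2 * t * (g ⬝ᵥ v) ^ 2 - 2 * m * (h ⬝ᵥ v) ^ 2 := by
      simp only [star_trivial, add_mulVec, sub_mulVec, one_mulVec, Matrix.smul_mulVec,
        vecMulVec_mulVec, dotProduct_add, dotProduct_sub, dotProduct_smul, smul_eq_mul,
        MulOpposite.smul_eq_mul_unop, MulOpposite.unop_op, dotProduct_comm v g,
        dotProduct_comm v h]
      ring
    rw [key]
    nlinarith [mul_nonneg ht (sq_nonneg (g ⬝ᵥ v)), mul_le_mul_of_nonneg_left hcs hm,
      mul_pos (sub_pos.2 hmh) hvv]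

/-- The Laplace transform identity of the noncentral Wishart law with `κ` degrees of freedom,
where `S` is the square root of `Sig`. -/
def HasWishartLaplace {Ω n : Type*} [MeasurableSpace Ω] [Fintype n] [DecidableEq n]
    (P : Measure Ω) (κ : ℝ) (Sig x S : Matrix n n ℝ) (X : Ω → Matrix n n ℝ) : Prop :=
  ∀ u : Matrix n n ℝ, u.IsSymm → (1 + (2 : ℝ) • (S * u * S)).PosDef →
    (∫ ω, Real.exp (-(u * X ω).trace) ∂P) =
      (1 + (2 : ℝ) • (u * Sig)).det ^ (-(κ / 2)) *
        Real.exp (-(u * (1 + (2 : ℝ) • (u * Sig))⁻¹ * x).trace)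

section Laplace

variable {Ω n : Type*} [MeasurableSpace Ω] [Fintype n] [DecidableEq n] {P : Measure Ω} {κ : ℝ}
  {Sig x S : Matrix n n ℝ} {X : Ω → Matrix n n ℝ}

theorem HasWishartLaplace.integral_rankTwo (hL : HasWishartLaplace P κ Sig x S X)
    (hS : S.IsSymm) (hSS : S * S = Sig) {e f : n → ℝ} (hef : (Sig *ᵥ e) ⬝ᵥ f = 0) {t m : ℝ}
    (ht : 0 ≤ t) (hm : 0 ≤ m) (hmf : 2 * m * ((Sig *ᵥ f) ⬝ᵥ f) < 1) :
    (∫ ω, Real.exp (-(t * (e ⬝ᵥ (X ω *ᵥ e)) - m * (f ⬝ᵥ (X ω *ᵥ f)))) ∂P) =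
      ((1 + 2 * t * ((Sig *ᵥ e) ⬝ᵥ e)) * (1 - 2 * m * ((Sig *ᵥ f) ⬝ᵥ f))) ^ (-(κ / 2)) *
        Real.exp (-(t * (e ⬝ᵥ (x *ᵥ e)) - m * (f ⬝ᵥ (x *ᵥ f)) -
          t * (2 * t / (1 + 2 * t * ((Sig *ᵥ e) ⬝ᵥ e))) *
            ((e ⬝ᵥ e) * ((Sig *ᵥ e) ⬝ᵥ (x *ᵥ e))) +
          t * (2 * m / (1 - 2 * m * ((Sig *ᵥ f) ⬝ᵥ f))) *
            ((e ⬝ᵥ f) * ((Sig *ᵥ f) ⬝ᵥ (x *ᵥ e))) +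
          m * (2 * t / (1 + 2 * t * ((Sig *ᵥ e) ⬝ᵥ e))) *
            ((e ⬝ᵥ f) * ((Sig *ᵥ e) ⬝ᵥ (x *ᵥ f))) -
          m * (2 * m / (1 - 2 * m * ((Sig *ᵥ f) ⬝ᵥ f))) *
            ((f ⬝ᵥ f) * ((Sig *ᵥ f) ⬝ᵥ (x *ᵥ f))))) := by
  have vecMul_S (v : n → ℝ) : v ᵥ* S = S *ᵥ v := by
    rw [← mulVec_transpose, hS.eq]
  have hSig : Sig.IsSymm := by rw [← hSS, IsSymm, transpose_mul, hS.eq]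
  have vecMul_Sig (v : n → ℝ) : v ᵥ* Sig = Sig *ᵥ v := by
    rw [← mulVec_transpose, hSig.eq]
  have dot_S (v : n → ℝ) : (S *ᵥ v) ⬝ᵥ (S *ᵥ v) = (Sig *ᵥ v) ⬝ᵥ v := by
    rw [← hSS, ← mulVec_mulVec, dotProduct_mulVec, vecMul_S]
  have hfe : (Sig *ᵥ f) ⬝ᵥ e = 0 := by
    rw [← vecMul_Sig, ← dotProduct_mulVec, dotProduct_comm, hef]
  have he : 0 ≤ (Sig *ᵥ e) ⬝ᵥ e := by
    rw [← dot_S]; simpa using dotProduct_star_self_nonneg (S *ᵥ e)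
  have hSuS : S * (t • vecMulVec e e - m • vecMulVec f f) * S =
      t • vecMulVec (S *ᵥ e) (S *ᵥ e) - m • vecMulVec (S *ᵥ f) (S *ᵥ f) := by
    simp only [mul_sub, sub_mul, Matrix.mul_smul, Matrix.smul_mul, mul_vecMulVec,
      vecMulVec_mul, vecMul_S]
  have huSig : (t • vecMulVec e e - m • vecMulVec f f) * Sig =
      t • vecMulVec e (Sig *ᵥ e) - m • vecMulVec f (Sig *ᵥ f) := by
    simp only [sub_mul, Matrix.smul_mul, vecMulVec_mul, vecMul_Sig]
  have h := hL (t • vecMulVec e e - m • vecMulVec f f)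
    (by simp [IsSymm, transpose_vecMulVec])
    (by rw [hSuS]; exact posDef_one_add_vecMulVec_sub _ _ ht hm (by rwa [dot_S]))
  rw [huSig, inv_one_add_smul_vecMulVec_sub hef hfe (by positivity) (by linarith),
    one_add_smul_vecMulVec_sub t m hef, det_mul, det_one_add_smul_vecMulVec,
    det_one_add_smul_vecMulVec, trace_rankTwo_mul_resolvent_mul, neg_mul, ← sub_eq_add_neg] at h
  simpa only [sub_mul, Matrix.smul_mul, trace_sub, trace_smul, trace_vecMulVec_mul,
    smul_eq_mul] using h

theorem HasWishartLaplace.rankOne_bound [IsProbabilityMeasure P]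
    (hL : HasWishartLaplace P κ Sig x S X) (hS : S.IsSymm) (hSS : S * S = Sig)
    (hX : ∀ ω, (X ω).PosSemidef) {e : n → ℝ} (he : 0 < (Sig *ᵥ e) ⬝ᵥ e) :
    (e ⬝ᵥ e) * ((Sig *ᵥ e) ⬝ᵥ (x *ᵥ e)) ≤ ((Sig *ᵥ e) ⬝ᵥ e) * (e ⬝ᵥ (x *ᵥ e)) := by
  set σ := (Sig *ᵥ e) ⬝ᵥ e with hσ
  set q := e ⬝ᵥ (x *ᵥ e)
  set r := (e ⬝ᵥ e) * ((Sig *ᵥ e) ⬝ᵥ (x *ᵥ e)) with hr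
  have bound : ∀ z : ℝ, 1 ≤ z →
      0 ≤ κ / 2 * Real.log z + (r / σ ^ 2 - q / (2 * σ)) + (-r / (2 * σ ^ 2)) / z +
        (q / (2 * σ) - r / (2 * σ ^ 2)) * z := by
    intro z hz
    have hz0 : 0 < z := by linarith
    have ht : 0 ≤ (z - 1) / (2 * σ) := div_nonneg (by linarith) (by linarith)
    have h := hL.integral_rankTwo hS hSS (e := e) (f := 0) (m := 0) (by simp) ht le_rfl
      (by simp)
    have hw : 1 + 2 * ((z - 1) / (2 * σ)) * σ = z := by field_simp; ring
    simp only [zero_dotProduct, dotProduct_zero, mulVec_zero, mul_zero, zero_mul, sub_zero,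
      add_zero, mul_one, ← hσ, ← hr, hw] at h
    have hle : (∫ ω, Real.exp (-((z - 1) / (2 * σ) * (e ⬝ᵥ (X ω *ᵥ e)))) ∂P) ≤ 1 := by
      calc _ ≤ ∫ _, (1 : ℝ) ∂P := by
            refine integral_mono_of_nonneg (.of_forall fun ω ↦ (Real.exp_pos _).le)
              (integrable_const _) (.of_forall fun ω ↦ Real.exp_le_one_iff.2 ?_)
            have := mul_nonneg ht (by simpa using (hX ω).dotProduct_mulVec_nonneg e)
            linarith
        _ = 1 := by simp
    rw [h, Real.rpow_def_of_pos hz0, ← Real.exp_add, Real.exp_le_one_iff] at hle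
    have hexp : (z - 1) / (2 * σ) * (2 * ((z - 1) / (2 * σ)) / z) * r =
        r / (2 * σ ^ 2) * (z - 2 + 1 / z) := by
      field_simp; ring
    rw [hexp] at hle
    refine (neg_nonneg.2 hle).trans_eq ?_
    field_simp
    ring
  have h := nonneg_of_forall_one_le_log_add bound
  have : q / (2 * σ) - r / (2 * σ ^ 2) = (σ * q - r) / (2 * σ ^ 2) := by field_simp
  rw [this, le_div_iff₀ (by positivity), zero_mul] at h
  linarith

theorem HasWishartLaplace.rankTwo_bound [IsProbabilityMeasure P]
    (hL : HasWishartLaplace P κ Sig x S X) (hS : S.IsSymm) (hSS : S * S = Sig)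
    (hX : ∀ ω, (X ω).PosSemidef) {e f : n → ℝ} (he : 0 ≤ (Sig *ᵥ e) ⬝ᵥ e)
    (hf : 0 < (Sig *ᵥ f) ⬝ᵥ f) (hef : (Sig *ᵥ e) ⬝ᵥ f = 0) :
    (e ⬝ᵥ f) * ((Sig *ᵥ f) ⬝ᵥ (x *ᵥ e)) ≤ 0 := by
  have key : ∀ t : ℝ, 0 ≤ t → 0 ≤ (f ⬝ᵥ f) * ((Sig *ᵥ f) ⬝ᵥ (x *ᵥ f)) /
        (2 * ((Sig *ᵥ f) ⬝ᵥ f) ^ 2) -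
      t * ((e ⬝ᵥ f) * ((Sig *ᵥ f) ⬝ᵥ (x *ᵥ e))) / ((Sig *ᵥ f) ⬝ᵥ f) := by
    intro t ht
    set w := 1 + 2 * t * ((Sig *ᵥ e) ⬝ᵥ e) with hw
    have hw0 : 0 < w := by positivity
    have hlow := hL.integral_rankTwo hS hSS hef ht le_rfl (by simp)
    have hup := fun (m : ℝ) (hm : 0 ≤ m) (hm1 : 2 * m * ((Sig *ᵥ f) ⬝ᵥ f) < 1) ↦
      hL.integral_rankTwo hS hSS hef ht hm hm1
    simp only [← hw] at hlow hup
    set ρ := (Sig *ᵥ f) ⬝ᵥ f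
    set G := (e ⬝ᵥ f) * ((Sig *ᵥ f) ⬝ᵥ (x *ᵥ e))
    set H := (e ⬝ᵥ f) * ((Sig *ᵥ e) ⬝ᵥ (x *ᵥ f))
    set J := (f ⬝ᵥ f) * ((Sig *ᵥ f) ⬝ᵥ (x *ᵥ f))
    set F := f ⬝ᵥ (x *ᵥ f)
    set a := t * (e ⬝ᵥ (x *ᵥ e))
    set τ := 2 * t / w
    set r := t * τ * ((e ⬝ᵥ e) * ((Sig *ᵥ e) ⬝ᵥ (x *ᵥ e)))
    refine nonneg_of_forall_one_le_log_add (a := κ / 2)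
      (b := F / (2 * ρ) - τ * H / (2 * ρ) + t * G / ρ - J / ρ ^ 2)
      (c := -F / (2 * ρ) + τ * H / (2 * ρ) + J / (2 * ρ ^ 2)) fun z hz ↦ ?_
    have hz0 : 0 < z := by linarith
    have hm : 0 ≤ (1 - z⁻¹) / (2 * ρ) :=
      div_nonneg (sub_nonneg.2 (inv_le_one_of_one_le₀ hz)) (by linarith)
    have hmρ : 2 * ((1 - z⁻¹) / (2 * ρ)) * ρ = 1 - z⁻¹ := by field_simp
    have h := hup _ hm (by rw [hmρ]; linarith [inv_pos.2 hz0])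
    rw [hmρ, sub_sub_cancel] at h
    have hint : Integrable (fun ω ↦ Real.exp (-(t * (e ⬝ᵥ (X ω *ᵥ e)) -
        (1 - z⁻¹) / (2 * ρ) * (f ⬝ᵥ (X ω *ᵥ f))))) P := by
      by_contra hni
      rw [integral_undef hni] at h
      exact absurd h (by positivity)
    have hle : (∫ ω, Real.exp (-(t * (e ⬝ᵥ (X ω *ᵥ e)) - 0 * (f ⬝ᵥ (X ω *ᵥ f)))) ∂P) ≤
        ∫ ω, Real.exp (-(t * (e ⬝ᵥ (X ω *ᵥ e)) -
          (1 - z⁻¹) / (2 * ρ) * (f ⬝ᵥ (X ω *ᵥ f)))) ∂P := by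
      refine integral_mono_of_nonneg (.of_forall fun ω ↦ (Real.exp_pos _).le) hint
        (.of_forall fun ω ↦ Real.exp_le_exp.2 ?_)
      have := mul_nonneg hm (by simpa using (hX ω).dotProduct_mulVec_nonneg f)
      linarith
    rw [hlow, h, Real.rpow_def_of_pos (by simpa using hw0), Real.rpow_def_of_pos (by positivity),
      ← Real.exp_add, ← Real.exp_add, Real.exp_le_exp,
      Real.log_mul hw0.ne' (inv_pos.2 hz0).ne', Real.log_inv] at hle
    simp only [mul_zero, zero_mul, sub_zero, mul_one, zero_div, add_zero] at hle
    refine (sub_nonneg.2 hle).trans_eq ?_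
    field_simp
    ring
  by_contra! hG
  have h := key ((Sig *ᵥ f ⬝ᵥ f) / ((e ⬝ᵥ f) * ((Sig *ᵥ f) ⬝ᵥ (x *ᵥ e))) *
    (|(f ⬝ᵥ f) * ((Sig *ᵥ f) ⬝ᵥ (x *ᵥ f)) / (2 * ((Sig *ᵥ f) ⬝ᵥ f) ^ 2)| + 1)) (by positivity)
  set j := (f ⬝ᵥ f) * ((Sig *ᵥ f) ⬝ᵥ (x *ᵥ f)) / (2 * ((Sig *ᵥ f) ⬝ᵥ f) ^ 2)
  have heq : (Sig *ᵥ f ⬝ᵥ f) / ((e ⬝ᵥ f) * ((Sig *ᵥ f) ⬝ᵥ (x *ᵥ e))) * (|j| + 1) *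
      ((e ⬝ᵥ f) * ((Sig *ᵥ f) ⬝ᵥ (x *ᵥ e))) / ((Sig *ᵥ f) ⬝ᵥ f) = |j| + 1 := by
    generalize (e ⬝ᵥ f) * ((Sig *ᵥ f) ⬝ᵥ (x *ᵥ e)) = G at hG
    generalize (Sig *ᵥ f) ⬝ᵥ f = ρ at hf
    field_simp
  rw [heq] at h
  linarith [le_abs_self j]

/-- Existence of `X` forces `x` or `Sig` to act as a scalar on each vector: `u` and `Sig` need not
commute, and the Laplace transform must be monotone as `u` degenerates along rank two matrices. -/
theorem HasWishartLaplace.eigenvector_or_eigenvector [IsProbabilityMeasure P]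
    (hL : HasWishartLaplace P κ Sig x S X) (hS : S.IsSymm) (hSS : S * S = Sig)
    (hSig : Sig.PosDef) (hX : ∀ ω, (X ω).PosSemidef) (e : n → ℝ) :
    (∃ c : ℝ, x *ᵥ e = c • e) ∨ ∃ c : ℝ, Sig *ᵥ e = c • e := by
  by_cases he0 : e = 0
  · exact Or.inl ⟨0, by simp [he0]⟩
  have pos {v : n → ℝ} (hv : v ≠ 0) : 0 < (Sig *ᵥ v) ⬝ᵥ v := by
    rw [dotProduct_comm]; simpa using hSig.dotProduct_mulVec_pos hv
  have symm (v w : n → ℝ) : (Sig *ᵥ v) ⬝ᵥ w = (Sig *ᵥ w) ⬝ᵥ v := by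
    have hT : Sigᵀ = Sig := by simpa [IsHermitian] using hSig.isHermitian
    rw [dotProduct_comm, dotProduct_mulVec, ← mulVec_transpose, hT]
  have hσ := pos he0
  have mul_inv : Sig * Sig⁻¹ = 1 := mul_nonsing_inv _ ((isUnit_iff_isUnit_det _).1 hSig.isUnit)
  set σ := (Sig *ᵥ e) ⬝ᵥ e with hσdef
  set a := x *ᵥ e - ((Sig *ᵥ e) ⬝ᵥ (x *ᵥ e) / σ) • e with ha
  set b := Sig⁻¹ *ᵥ e - ((e ⬝ᵥ e) / σ) • e with hb
  have hSigb : Sig *ᵥ b = e - ((e ⬝ᵥ e) / σ) • (Sig *ᵥ e) := by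
    rw [hb, mulVec_sub, mulVec_smul, mulVec_mulVec, mul_inv, one_mulVec]
  have hea : (Sig *ᵥ e) ⬝ᵥ a = 0 := by
    rw [ha, dotProduct_sub, dotProduct_smul, smul_eq_mul, ← hσdef]
    field_simp
    ring
  have heb : (Sig *ᵥ e) ⬝ᵥ b = 0 := by
    rw [symm, hSigb, sub_dotProduct, smul_dotProduct, smul_eq_mul, ← hσdef]
    field_simp
    ring
  have dot_e {f : n → ℝ} (hf : (Sig *ᵥ e) ⬝ᵥ f = 0) : e ⬝ᵥ f = (Sig *ᵥ f) ⬝ᵥ b := by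
    rw [symm, hSigb, sub_dotProduct, smul_dotProduct, hf, smul_zero, sub_zero]
  have dot_xe {f : n → ℝ} (hf : (Sig *ᵥ e) ⬝ᵥ f = 0) :
      (Sig *ᵥ f) ⬝ᵥ (x *ᵥ e) = (Sig *ᵥ f) ⬝ᵥ a := by
    rw [ha, dotProduct_sub, dotProduct_smul, symm f e, hf, smul_zero, sub_zero]
  have hab : 0 ≤ (Sig *ᵥ a) ⬝ᵥ b := by
    rw [← dot_e hea, ha, dotProduct_sub, dotProduct_smul, smul_eq_mul]
    have h := hL.rankOne_bound hS hSS hX hσ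
    have : e ⬝ᵥ (x *ᵥ e) - (Sig *ᵥ e) ⬝ᵥ (x *ᵥ e) / σ * (e ⬝ᵥ e) =
        (σ * (e ⬝ᵥ (x *ᵥ e)) - (e ⬝ᵥ e) * ((Sig *ᵥ e) ⬝ᵥ (x *ᵥ e))) / σ := by
      field_simp
    rw [this]
    exact div_nonneg (sub_nonneg.2 h) hσ.le
  have neg {f : n → ℝ} (hf : (Sig *ᵥ e) ⬝ᵥ f = 0) :
      ((Sig *ᵥ f) ⬝ᵥ b) * ((Sig *ᵥ f) ⬝ᵥ a) ≤ 0 := by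
    by_cases hf0 : f = 0
    · simp [hf0]
    rw [← dot_e hf, ← dot_xe hf]
    exact hL.rankTwo_bound hS hSS hX hσ.le (pos hf0) hf
  by_cases ha0 : a = 0
  · exact Or.inl ⟨_, sub_eq_zero.1 ha0⟩
  by_cases hb0 : b = 0
  · right
    rw [hb0, mulVec_zero, eq_comm, sub_eq_zero] at hSigb
    have hee : 0 < e ⬝ᵥ e := by simpa using dotProduct_star_self_pos_iff.2 he0
    exact ⟨((e ⬝ᵥ e) / σ)⁻¹, (eq_inv_smul_iff₀ (div_pos hee hσ).ne').2 hSigb.symm⟩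
  exfalso
  have hA := pos ha0
  have hB := pos hb0
  have hab0 : (Sig *ᵥ a) ⬝ᵥ b = 0 := le_antisymm (by nlinarith [neg hea]) hab
  have h := neg (f := a + b) (by rw [dotProduct_add, hea, heb, add_zero])
  rw [mulVec_add, add_dotProduct, add_dotProduct, symm b a, hab0, zero_add, add_zero] at h
  exact absurd h (not_le.2 (mul_pos hB hA))

end Laplace

theorem trace_mul_inv_mul_of_scalar {n : Type*} [Fintype n] [DecidableEq n]
    {Sig x : Matrix n n ℝ} (u : Matrix n n ℝ)
    (h : (∃ c : ℝ, x = c • (1 : Matrix n n ℝ)) ∨ ∃ c : ℝ, Sig = c • (1 : Matrix n n ℝ)) :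
    (u * (1 + (2 : ℝ) • (u * Sig))⁻¹ * x).trace =
      ((1 + (2 : ℝ) • (u * Sig))⁻¹ * u * x).trace := by
  rcases h with ⟨c, rfl⟩ | ⟨c, rfl⟩
  · rw [Matrix.mul_smul, Matrix.mul_smul, mul_one, mul_one, trace_smul, trace_smul, trace_mul_comm]
  · have hcomm : Commute u (1 + (2 : ℝ) • (u * c • (1 : Matrix n n ℝ))) := by
      simp only [Matrix.mul_smul, mul_one]
      exact (Commute.one_right u).add_right (((Commute.refl u).smul_right c).smul_right 2)
    by_cases hdet : IsUnit (1 + (2 : ℝ) • (u * c • (1 : Matrix n n ℝ))).det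
    · generalize (1 + (2 : ℝ) • (u * c • (1 : Matrix n n ℝ))) = B at hcomm hdet
      congr 2
      calc u * B⁻¹ = B⁻¹ * B * (u * B⁻¹) := by rw [nonsing_inv_mul _ hdet, one_mul]
        _ = B⁻¹ * (u * B) * B⁻¹ := by rw [hcomm.eq]; simp only [mul_assoc]
        _ = B⁻¹ * u := by rw [mul_assoc, mul_assoc, mul_nonsing_inv _ hdet, mul_one]
    · rw [nonsing_inv_apply_not_isUnit _ hdet, mul_zero, zero_mul u]

/-- Let `X` be a random symmetric positive semidefinite `d×d` matrix with a
noncentral Wishart law `W_d(κ, Σ, Σ⁻¹x)`: its Laplace transform satisfies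
`E[e^{-Tr(uX)}] = det(I + 2uΣ)^{-κ/2} exp(-Tr(u(I+2uΣ)⁻¹x))` for every symmetric `u` such
that `I + 2Σ^{1/2}uΣ^{1/2}` is positive definite.  Let `A` be symmetric, let
`Σ^{1/2}AΣ^{1/2} = OΛOᵀ` be a spectral decomposition and `y = OᵀΣ^{-1/2}xΣ^{-1/2}O`.  Then
for every real `s` with `1 - 2sλ_i > 0` for all `i`,
`E[e^{s Tr(AX)}] = ∏_i (1-2sλ_i)^{-κ/2} exp(sλ_i y_{ii}/(1-2sλ_i))`, i.e. `Tr(AX)` has the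
moment generating function of `∑ λ_i V_i` with `V_i` independent noncentral chi-squares
`χ²(κ, y_{ii})`. -/
theorem stmt_17
    {Ω : Type*} [MeasurableSpace Ω] (P : Measure Ω) [IsProbabilityMeasure P]
    (d : ℕ) (hd : 1 ≤ d) (κ : ℝ) (hκ : 0 < κ)
    -- the parameters: `Σ` symmetric positive definite, `x` symmetric positive semidefinite
    (Sig x A : Matrix (Fin d) (Fin d) ℝ)
    (hSigsym : Sig.IsSymm) (hSigpd : Sig.PosDef)
    (hxsym : x.IsSymm) (hxpsd : x.PosSemidef)
    (hAsym : A.IsSymm)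
    -- the positive definite square root `Σ^{1/2}` of `Σ`
    (Shalf : Matrix (Fin d) (Fin d) ℝ)
    (hShalfsym : Shalf.IsSymm) (hShalfpd : Shalf.PosDef)
    (hShalfsq : Shalf * Shalf = Sig)
    -- the random matrix `X` with noncentral Wishart law `W_d(κ, Σ, Σ⁻¹x)`, via its
    -- Laplace transform
    (X : Ω → Matrix (Fin d) (Fin d) ℝ)
    (hXpsd : ∀ ω, (X ω).PosSemidef)
    (hLap : ∀ u : Matrix (Fin d) (Fin d) ℝ, u.IsSymm →
      (1 + (2:ℝ) • (Shalf * u * Shalf)).PosDef →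
      (∫ ω, Real.exp (-Matrix.trace (u * X ω)) ∂P) =
        (1 + (2:ℝ) • (u * Sig)).det ^ (-(κ / 2)) *
          Real.exp (-Matrix.trace (u * (1 + (2:ℝ) • (u * Sig))⁻¹ * x)))
    -- the spectral decomposition `Σ^{1/2} A Σ^{1/2} = O Λ Oᵀ` with `O` orthogonal
    (O : Matrix (Fin d) (Fin d) ℝ)
    (hO : O * Oᵀ = 1 ∧ Oᵀ * O = 1)
    (lam : Fin d → ℝ)
    (hspec : Shalf * A * Shalf = O * Matrix.diagonal lam * Oᵀ)
    -- the matrix of noncentrality parameters `y = Oᵀ Σ^{-1/2} x Σ^{-1/2} O`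
    (y : Matrix (Fin d) (Fin d) ℝ)
    (hy : y = Oᵀ * Shalf⁻¹ * x * Shalf⁻¹ * O)
    -- conclusion: for every `s` with `1 - 2sλ_i > 0` for all `i`
    (s : ℝ) (hs : ∀ i, 0 < 1 - 2 * s * lam i) :
    (∫ ω, Real.exp (s * Matrix.trace (A * X ω)) ∂P) =
      ∏ i : Fin d, ((1 - 2 * s * lam i) ^ (-(κ / 2)) *
        Real.exp (s * lam i * y i i / (1 - 2 * s * lam i))) := by
  have : Nonempty (Fin d) := ⟨⟨0, hd⟩⟩
  have hL : HasWishartLaplace P κ Sig x Shalf X := hLap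
  have hscalar := exists_eq_smul_one_of_forall_eigenvector x Sig
    (hL.eigenvector_or_eigenvector hShalfsym hShalfsq hSigpd hXpsd)
  have hSdet : IsUnit Shalf.det := (isUnit_iff_isUnit_det _).1 hShalfpd.isUnit
  set D : Matrix (Fin d) (Fin d) ℝ := diagonal fun i ↦ 1 - 2 * s * lam i with hD
  have hDeq : D = 1 + (2 : ℝ) • ((-s) • diagonal lam) := by
    rw [hD, ← diagonal_one, ← diagonal_smul, ← diagonal_smul, diagonal_add]
    congr 1
    ext i
    simp only [Pi.smul_apply, smul_eq_mul]
    ring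
  have hOD : O * D * Oᵀ = 1 + (2 : ℝ) • (Shalf * ((-s) • A) * Shalf) := by
    rw [hDeq, Matrix.mul_smul, Matrix.smul_mul, hspec]
    simp only [mul_add, add_mul, mul_one, hO.1, Matrix.mul_smul, Matrix.smul_mul]
  have hpd : (1 + (2 : ℝ) • (Shalf * ((-s) • A) * Shalf)).PosDef := by
    rw [← hOD, ← conjTranspose_eq_transpose_of_trivial]
    refine (PosDef.diagonal hs).mul_mul_conjTranspose_same ?_
    exact vecMul_injective_of_isUnit (.of_mul_eq_one _ hO.1)
  have hA : A = Shalf⁻¹ * O * diagonal lam * (Oᵀ * Shalf⁻¹) := by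
    have h := congrArg (fun M ↦ Shalf⁻¹ * M * Shalf⁻¹) hspec
    simp only [mul_assoc, mul_nonsing_inv _ hSdet, mul_one,
      nonsing_inv_mul_cancel_left _ _ hSdet] at h
    rw [h]
    simp only [mul_assoc]
  have hNM : Oᵀ * Shalf * (Shalf⁻¹ * O) = 1 := by
    rw [mul_assoc, mul_nonsing_inv_cancel_left _ _ hSdet, hO.2]
  have hMN : Shalf⁻¹ * O * (Oᵀ * Shalf) = 1 := by
    rw [mul_assoc, ← mul_assoc O, hO.1, one_mul, nonsing_inv_mul _ hSdet]
  have hB : 1 + (2 : ℝ) • ((-s) • A * Sig) = Shalf⁻¹ * O * D * (Oᵀ * Shalf) := by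
    have hASig : A * Sig = Shalf⁻¹ * O * diagonal lam * (Oᵀ * Shalf) := by
      rw [hA, ← hShalfsq]
      simp only [mul_assoc, nonsing_inv_mul_cancel_left _ _ hSdet]
    rw [Matrix.smul_mul, hASig, hDeq, mul_add, add_mul, mul_one, hMN]
    simp only [Matrix.mul_smul, Matrix.smul_mul]
  set E : Matrix (Fin d) (Fin d) ℝ := diagonal fun i ↦ (1 - 2 * s * lam i)⁻¹ with hE
  have hDE : D * E = 1 := by
    rw [hD, hE, diagonal_mul_diagonal, ← diagonal_one]
    congr 1
    ext i
    exact mul_inv_cancel₀ (hs i).ne'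
  have hBinv : (1 + (2 : ℝ) • ((-s) • A * Sig))⁻¹ = Shalf⁻¹ * O * E * (Oᵀ * Shalf) := by
    rw [hB]
    refine inv_eq_right_inv ?_
    calc Shalf⁻¹ * O * D * (Oᵀ * Shalf) * (Shalf⁻¹ * O * E * (Oᵀ * Shalf))
        = Shalf⁻¹ * O * D * (Oᵀ * Shalf * (Shalf⁻¹ * O)) * E * (Oᵀ * Shalf) := by
          simp only [mul_assoc]
      _ = 1 := by rw [hNM, mul_one, mul_assoc (Shalf⁻¹ * O), hDE, mul_one, hMN]
  have hdet : (1 + (2 : ℝ) • ((-s) • A * Sig)).det = ∏ i, (1 - 2 * s * lam i) := by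
    rw [hB, det_mul_comm, ← mul_assoc, hNM, one_mul, hD, det_diagonal]
  have htr : ((-s) • A * (1 + (2 : ℝ) • ((-s) • A * Sig))⁻¹ * x).trace =
      -∑ i, s * lam i * y i i / (1 - 2 * s * lam i) := by
    have hprod : (1 + (2 : ℝ) • ((-s) • A * Sig))⁻¹ * ((-s) • A) * x =
        (-s) • (Shalf⁻¹ * O * (E * diagonal lam * (Oᵀ * Shalf⁻¹ * x))) := by
      rw [hBinv, Matrix.mul_smul, Matrix.smul_mul]
      congr 1
      nth_rw 1 [hA]
      calc Shalf⁻¹ * O * E * (Oᵀ * Shalf) *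
            (Shalf⁻¹ * O * diagonal lam * (Oᵀ * Shalf⁻¹)) * x
          = Shalf⁻¹ * O * E * (Oᵀ * Shalf * (Shalf⁻¹ * O)) *
            (diagonal lam * (Oᵀ * Shalf⁻¹) * x) := by simp only [mul_assoc]
        _ = _ := by rw [hNM, mul_one]; simp only [mul_assoc]
    rw [trace_mul_inv_mul_of_scalar _ hscalar, hprod, trace_smul, trace_mul_comm]
    have hy' : E * diagonal lam * (Oᵀ * Shalf⁻¹ * x) * (Shalf⁻¹ * O) =
        E * diagonal lam * y := by
      rw [hy]; simp only [mul_assoc]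
    rw [hy', hE, diagonal_mul_diagonal, trace, Finset.smul_sum, ← Finset.sum_neg_distrib]
    refine Finset.sum_congr rfl fun i _ ↦ ?_
    rw [diag_apply, diagonal_mul, smul_eq_mul]
    ring
  have h := hLap ((-s) • A) (hAsym.smul (-s)) hpd
  rw [hdet, htr, neg_neg, Real.exp_sum, ← Real.finsetProd_rpow _ _ fun i _ ↦ (hs i).le,
    ← Finset.prod_mul_distrib] at h
  rw [← h]
  congr 1
  ext ω
  rw [Matrix.smul_mul, trace_smul, smul_eq_mul, neg_mul, neg_neg]
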